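/- arXiv:2201.00659 — 9 statements merged into one kernel-verified Lean document; each statement's English description precedes it below -/
import Mathlib

section
/- For every C^∞ function h : ℝ² → ℝ and every (u,v) ∈ I × ℝ, the ℝ³-valued identity (∂h/∂u)(u,v)·x_u(u,v) + (1/f(u)²)(∂h/∂v)(u,v)·x_v(u,v) + (1/φ'(u))(∂h/∂u)(u,v)·N_u(u,v) + (1/(f(u) sin φ(u)))(∂h/∂v)(u,v)·N_v(u,v) = 0 holds, where subscripts u,v denote partial derivatives of the maps x and N. (This expresses the relation ∇^I(h,x) + ∇^{II}(h,N) = 0, using that the first fundamental form of x has coefficients g₁₁ = 1, g₁₂ = 0, g₂₂ = f² and the second fundamental form has coefficients b₁₁ = φ', b₁₂ = 0, b₂₂ = f sin φ.) -/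
open Real

/-- The surface of revolution `x(u,v) = (f(u) cos v, f(u) sin v, g(u))`. -/
noncomputable def xMap (f g : ℝ → ℝ) (u v : ℝ) : ℝ × ℝ × ℝ :=
  (f u * Real.cos v, f u * Real.sin v, g u)

/-- The Gauss map `N(u,v) = (−sin φ(u) cos v, −sin φ(u) sin v, cos φ(u))`. -/
noncomputable def nMap (φ : ℝ → ℝ) (u v : ℝ) : ℝ × ℝ × ℝ :=
  (-(Real.sin (φ u)) * Real.cos v, -(Real.sin (φ u)) * Real.sin v, Real.cos (φ u))

theorem HasDerivAt.xMap_left {f g : ℝ → ℝ} {f' g' u : ℝ} (hf : HasDerivAt f f' u)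
    (hg : HasDerivAt g g' u) (v : ℝ) :
    HasDerivAt (fun t => xMap f g t v) (f' * Real.cos v, f' * Real.sin v, g') u :=
  (hf.mul_const _).prodMk ((hf.mul_const _).prodMk hg)

theorem hasDerivAt_xMap_right (f g : ℝ → ℝ) (u v : ℝ) :
    HasDerivAt (fun t => xMap f g u t) (f u * -Real.sin v, f u * Real.cos v, 0) v :=
  ((Real.hasDerivAt_cos v).const_mul _).prodMk
    (((Real.hasDerivAt_sin v).const_mul _).prodMk (hasDerivAt_const v _))

theorem HasDerivAt.nMap_left {φ : ℝ → ℝ} {φ' u : ℝ} (hφ : HasDerivAt φ φ' u) (v : ℝ) :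
    HasDerivAt (fun t => nMap φ t v)
      (-(Real.cos (φ u) * φ') * Real.cos v, -(Real.cos (φ u) * φ') * Real.sin v,
        -Real.sin (φ u) * φ') u :=
  (hφ.sin.neg.mul_const _).prodMk ((hφ.sin.neg.mul_const _).prodMk hφ.cos)

theorem hasDerivAt_nMap_right (φ : ℝ → ℝ) (u v : ℝ) :
    HasDerivAt (fun t => nMap φ u t)
      (-Real.sin (φ u) * -Real.sin v, -Real.sin (φ u) * Real.cos v, 0) v :=
  ((Real.hasDerivAt_cos v).const_mul _).prodMk
    (((Real.hasDerivAt_sin v).const_mul _).prodMk (hasDerivAt_const v _))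

/-- the relation ∇^I(h,x) + ∇^II(h,N) = 0 for the surface of revolution. -/
theorem nablaI_x_add_nablaII_N_eq_zero
    (a b : ℝ) (φ f g : ℝ → ℝ)
    (hφ : ContDiff ℝ (⊤ : ℕ∞) φ) (hf : ContDiff ℝ (⊤ : ℕ∞) f) (hg : ContDiff ℝ (⊤ : ℕ∞) g)
    (hfd : ∀ u ∈ Set.Ioo a b, deriv f u = Real.cos (φ u))
    (hgd : ∀ u ∈ Set.Ioo a b, deriv g u = Real.sin (φ u))
    (hfpos : ∀ u ∈ Set.Ioo a b, 0 < f u)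
    (hsin : ∀ u ∈ Set.Ioo a b, Real.sin (φ u) ≠ 0)
    (hφd : ∀ u ∈ Set.Ioo a b, deriv φ u ≠ 0)
    (h : ℝ → ℝ → ℝ) (hh : ContDiff ℝ (⊤ : ℕ∞) (Function.uncurry h)) :
    ∀ u ∈ Set.Ioo a b, ∀ v : ℝ,
      (deriv (fun t => h t v) u) • deriv (fun t => xMap f g t v) u
        + ((1 / f u ^ 2) * deriv (fun t => h u t) v) • deriv (fun t => xMap f g u t) v
        + ((1 / deriv φ u) * deriv (fun t => h t v) u) • deriv (fun t => nMap φ t v) u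
        + ((1 / (f u * Real.sin (φ u))) * deriv (fun t => h u t) v) •
            deriv (fun t => nMap φ u t) v
      = (0 : ℝ × ℝ × ℝ) := by
  intro u hu v
  have hf' := (hf.differentiable (by simp) u).hasDerivAt
  have hg' := (hg.differentiable (by simp) u).hasDerivAt
  have hφ' := (hφ.differentiable (by simp) u).hasDerivAt
  rw [hfd u hu] at hf'
  rw [hgd u hu] at hg'
  rw [(hf'.xMap_left hg' v).deriv, (hasDerivAt_xMap_right f g u v).deriv,
    (hφ'.nMap_left v).deriv, (hasDerivAt_nMap_right φ u v).deriv]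
  have hfu := (hfpos u hu).ne'
  have hsu := hsin u hu
  have hφu := hφd u hu
  ext <;> simp only [Prod.smul_mk, Prod.mk_add_mk, smul_eq_mul, Prod.fst_zero, Prod.snd_zero] <;>
    field_simp <;> ring
end

section
/- At every (u,v) ∈ I × ℝ: Δ^{III}(f(u) cos v) = (φ''(u) cos φ(u)/φ'(u)³ − 1/(φ'(u) sin φ(u)) + 2 sin φ(u)/φ'(u) + f(u)/sin²φ(u)) cos v, Δ^{III}(f(u) sin v) = (φ''(u) cos φ(u)/φ'(u)³ − 1/(φ'(u) sin φ(u)) + 2 sin φ(u)/φ'(u) + f(u)/sin²φ(u)) sin v, and Δ^{III} g(u) = −2 cos φ(u)/φ'(u) + φ''(u) sin φ(u)/φ'(u)³. -/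
open Real

/-- The Laplace operator of the third fundamental form:
`Δ^III h = −(1/φ'²) h_uu + (φ''/φ'³ − cos φ/(φ' sin φ)) h_u − (1/sin² φ) h_vv`. -/
noncomputable def lapIII (φ : ℝ → ℝ) (h : ℝ → ℝ → ℝ) : ℝ → ℝ → ℝ := fun u v =>
  -(1 / (deriv φ u) ^ 2) * deriv (deriv (fun s => h s v)) u
    + (deriv (deriv φ) u / (deriv φ u) ^ 3
        - Real.cos (φ u) / (deriv φ u * Real.sin (φ u))) * deriv (fun s => h s v) u
    - (1 / Real.sin (φ u) ^ 2) * deriv (deriv (fun s => h u s)) v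

theorem deriv_deriv_eq_of_eqOn {s : Set ℝ} (hs : IsOpen s) {p q : ℝ → ℝ}
    (h : Set.EqOn (deriv p) q s) {u : ℝ} (hu : u ∈ s) : deriv (deriv p) u = deriv q u :=
  (h.eventuallyEq_of_mem (hs.mem_nhds hu)).deriv_eq

theorem lapIII_mul (φ f c : ℝ → ℝ) (u v : ℝ) :
    lapIII φ (fun s t => f s * c t) u v =
      (-(1 / (deriv φ u) ^ 2) * deriv (deriv f) u
        + (deriv (deriv φ) u / (deriv φ u) ^ 3
          - Real.cos (φ u) / (deriv φ u * Real.sin (φ u))) * deriv f u) * c v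
        - (1 / Real.sin (φ u) ^ 2) * (f u * deriv (deriv c) v) := by
  simp only [lapIII, deriv_mul_const_field', deriv_mul_const_field, deriv_const_mul_field',
    deriv_const_mul_field]
  ring

theorem lapIII_mul_of_deriv_deriv_eq_neg {φ f c : ℝ → ℝ} {u v : ℝ}
    (hf : deriv f u = Real.cos (φ u)) (hff : deriv (deriv f) u = -Real.sin (φ u) * deriv φ u)
    (hc : deriv (deriv c) v = -c v) (hsin : Real.sin (φ u) ≠ 0) (hφ : deriv φ u ≠ 0) :
    lapIII φ (fun s t => f s * c t) u v =
      (deriv (deriv φ) u * Real.cos (φ u) / (deriv φ u) ^ 3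
        - 1 / (deriv φ u * Real.sin (φ u))
        + 2 * Real.sin (φ u) / deriv φ u
        + f u / Real.sin (φ u) ^ 2) * c v := by
  rw [lapIII_mul, hf, hff, hc]
  field_simp
  linear_combination
    -(c v * Real.sin (φ u) * deriv φ u ^ 2) * Real.sin_sq_add_cos_sq (φ u)

/-- the values of Δ^III on the coordinate functions of the surface of revolution. -/
theorem lapIII_coordinates
    (a b : ℝ) (φ f g : ℝ → ℝ)
    (hφ : ContDiff ℝ (⊤ : ℕ∞) φ) (hf : ContDiff ℝ (⊤ : ℕ∞) f) (hg : ContDiff ℝ (⊤ : ℕ∞) g)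
    (hfd : ∀ u ∈ Set.Ioo a b, deriv f u = Real.cos (φ u))
    (hgd : ∀ u ∈ Set.Ioo a b, deriv g u = Real.sin (φ u))
    (hfpos : ∀ u ∈ Set.Ioo a b, 0 < f u)
    (hsin : ∀ u ∈ Set.Ioo a b, Real.sin (φ u) ≠ 0)
    (hφd : ∀ u ∈ Set.Ioo a b, deriv φ u ≠ 0)
    :
    ∀ u ∈ Set.Ioo a b, ∀ v : ℝ,
      lapIII φ (fun s t => f s * Real.cos t) u v
          = (deriv (deriv φ) u * Real.cos (φ u) / (deriv φ u) ^ 3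
              - 1 / (deriv φ u * Real.sin (φ u))
              + 2 * Real.sin (φ u) / deriv φ u
              + f u / Real.sin (φ u) ^ 2) * Real.cos v
        ∧ lapIII φ (fun s t => f s * Real.sin t) u v
          = (deriv (deriv φ) u * Real.cos (φ u) / (deriv φ u) ^ 3
              - 1 / (deriv φ u * Real.sin (φ u))
              + 2 * Real.sin (φ u) / deriv φ u
              + f u / Real.sin (φ u) ^ 2) * Real.sin v
        ∧ lapIII φ (fun s _ => g s) u v
          = -(2 * Real.cos (φ u) / deriv φ u)
              + deriv (deriv φ) u * Real.sin (φ u) / (deriv φ u) ^ 3 := by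
  intro u hu v
  have hφu : DifferentiableAt ℝ φ u := hφ.differentiable (by simp) u
  have hff : deriv (deriv f) u = -Real.sin (φ u) * deriv φ u := by
    rw [deriv_deriv_eq_of_eqOn isOpen_Ioo hfd hu]
    exact hφu.hasDerivAt.cos.deriv
  have hgg : deriv (deriv g) u = Real.cos (φ u) * deriv φ u := by
    rw [deriv_deriv_eq_of_eqOn isOpen_Ioo hgd hu]
    exact hφu.hasDerivAt.sin.deriv
  have hs := hsin u hu
  have hd := hφd u hu
  refine ⟨lapIII_mul_of_deriv_deriv_eq_neg (hfd u hu) hff (by simp) hs hd,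
    lapIII_mul_of_deriv_deriv_eq_neg (hfd u hu) hff (by simp) hs hd, ?_⟩
  have hlap := lapIII_mul φ g (fun _ => 1) u v
  simp only [mul_one, deriv_const', mul_zero, sub_zero] at hlap
  rw [hlap, hgg, hgd u hu]
  field_simp
  ring
end

section
/- At every (u,v) ∈ I × ℝ, the three coordinate functions of x satisfy Δ^{III} x₁ = (R(u) sin φ(u) − R'(u) cos φ(u)/φ'(u)) cos v, Δ^{III} x₂ = (R(u) sin φ(u) − R'(u) cos φ(u)/φ'(u)) sin v, and Δ^{III} x₃ = −R'(u) sin φ(u)/φ'(u) − R(u) cos φ(u); equivalently, Δ^{III} x = −(R'(u)/φ'(u)) ∂x/∂u − R(u) N(u,v) as an ℝ³-valued identity (this is the formula Δ^{III} x = ∇^{III}(R, N) − R N). -/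
open Real

/-- The sum of the principal radii of curvature `R = f/sin φ + 1/φ'`. -/
noncomputable def Rsum (φ f : ℝ → ℝ) (u : ℝ) : ℝ :=
  f u / Real.sin (φ u) + 1 / deriv φ u

/-- The derivative of the sum of the principal radii of curvature, when `f' = cos φ`. -/
lemma hasDerivAt_Rsum {φ f : ℝ → ℝ} {u φ' φ'' : ℝ} (hf : HasDerivAt f (Real.cos (φ u)) u)
    (hφ : HasDerivAt φ φ' u) (hφ' : HasDerivAt (deriv φ) φ'' u)
    (hs : Real.sin (φ u) ≠ 0) (hd : deriv φ u ≠ 0) :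
    HasDerivAt (Rsum φ f)
      ((Real.cos (φ u) * Real.sin (φ u) - f u * (Real.cos (φ u) * φ')) / Real.sin (φ u) ^ 2
        - φ'' / deriv φ u ^ 2) u := by
  have h := (hf.div hφ.sin hs).add (hφ'.inv hd)
  have hfun : Rsum φ f = (f / fun x => Real.sin (φ x)) + (deriv φ)⁻¹ := by
    funext s
    simp [Rsum]
  rwa [hfun, sub_eq_add_neg, ← neg_div]

lemma deriv_deriv_const_mul_cos (c v : ℝ) :
    deriv (deriv fun t => c * Real.cos t) v = -(c * Real.cos v) := by
  have h : (deriv fun t => c * Real.cos t) = fun t => -c * Real.sin t := by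
    funext t
    rw [((Real.hasDerivAt_cos t).const_mul c).deriv]
    ring
  rw [h, ((Real.hasDerivAt_sin v).const_mul (-c)).deriv]
  ring

lemma deriv_deriv_const_mul_sin (c v : ℝ) :
    deriv (deriv fun t => c * Real.sin t) v = -(c * Real.sin v) := by
  have h : (deriv fun t => c * Real.sin t) = fun t => c * Real.cos t := by
    funext t
    exact ((Real.hasDerivAt_sin t).const_mul c).deriv
  rw [h, ((Real.hasDerivAt_cos v).const_mul c).deriv]
  ring

lemma deriv_deriv_mul_const (f : ℝ → ℝ) (c u : ℝ) :
    deriv (deriv fun s => f s * c) u = deriv (deriv f) u * c := by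
  have h : (deriv fun s => f s * c) = fun s => deriv f s * c := by
    funext s
    exact deriv_mul_const_field c
  rw [h, deriv_mul_const_field]

/-- Δ^III x = ∇^III(R,N) − R N for the surface of revolution. -/
theorem lapIII_x_eq_nablaIII_R_N_sub_R_N
    (a b : ℝ) (φ f g : ℝ → ℝ)
    (hφ : ContDiff ℝ (⊤ : ℕ∞) φ) (hf : ContDiff ℝ (⊤ : ℕ∞) f) (hg : ContDiff ℝ (⊤ : ℕ∞) g)
    (hfd : ∀ u ∈ Set.Ioo a b, deriv f u = Real.cos (φ u))
    (hgd : ∀ u ∈ Set.Ioo a b, deriv g u = Real.sin (φ u))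
    (hfpos : ∀ u ∈ Set.Ioo a b, 0 < f u)
    (hsin : ∀ u ∈ Set.Ioo a b, Real.sin (φ u) ≠ 0)
    (hφd : ∀ u ∈ Set.Ioo a b, deriv φ u ≠ 0)
    :
    ∀ u ∈ Set.Ioo a b, ∀ v : ℝ,
      (lapIII φ (fun s t => f s * Real.cos t) u v
          = (Rsum φ f u * Real.sin (φ u)
              - deriv (Rsum φ f) u * Real.cos (φ u) / deriv φ u) * Real.cos v
        ∧ lapIII φ (fun s t => f s * Real.sin t) u v
          = (Rsum φ f u * Real.sin (φ u)
              - deriv (Rsum φ f) u * Real.cos (φ u) / deriv φ u) * Real.sin v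
        ∧ lapIII φ (fun s _ => g s) u v
          = -(deriv (Rsum φ f) u * Real.sin (φ u) / deriv φ u)
              - Rsum φ f u * Real.cos (φ u))
      ∧ (lapIII φ (fun s t => f s * Real.cos t) u v,
          lapIII φ (fun s t => f s * Real.sin t) u v,
          lapIII φ (fun s _ => g s) u v)
        = (-(deriv (Rsum φ f) u / deriv φ u)) • deriv (fun t => xMap f g t v) u
            - Rsum φ f u • nMap φ u v := by
  intro u hu v
  have hnhds : Set.Ioo a b ∈ nhds u := isOpen_Ioo.mem_nhds hu
  have hs := hsin u hu
  have hd := hφd u hu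
  have hφu : HasDerivAt φ (deriv φ u) u := (hφ.differentiable (by simp) u).hasDerivAt
  have hφ'u : HasDerivAt (deriv φ) (deriv (deriv φ) u) u :=
    ((hφ.iterate_deriv 1).differentiable (by simp) u).hasDerivAt
  have hfu : HasDerivAt f (Real.cos (φ u)) u :=
    hfd u hu ▸ (hf.differentiable (by simp) u).hasDerivAt
  have hgu : HasDerivAt g (Real.sin (φ u)) u :=
    hgd u hu ▸ (hg.differentiable (by simp) u).hasDerivAt
  have hf2 : deriv (deriv f) u = -Real.sin (φ u) * deriv φ u := by
    have h : deriv f =ᶠ[nhds u] fun s => Real.cos (φ s) := Filter.eventually_of_mem hnhds hfd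
    rw [h.deriv_eq, hφu.cos.deriv]
  have hg2 : deriv (deriv g) u = Real.cos (φ u) * deriv φ u := by
    have h : deriv g =ᶠ[nhds u] fun s => Real.sin (φ s) := Filter.eventually_of_mem hnhds hgd
    rw [h.deriv_eq, hφu.sin.deriv]
  have hR := (hasDerivAt_Rsum hfu hφu hφ'u hs hd).deriv
  have hx : deriv (fun t => xMap f g t v) u
      = (Real.cos (φ u) * Real.cos v, Real.cos (φ u) * Real.sin v, Real.sin (φ u)) :=
    ((hfu.mul_const _).prodMk ((hfu.mul_const _).prodMk hgu)).deriv
  have hcoef : Real.sin (φ u) / deriv φ u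
      + (deriv (deriv φ) u / deriv φ u ^ 3
        - Real.cos (φ u) / (deriv φ u * Real.sin (φ u))) * Real.cos (φ u)
      + f u / Real.sin (φ u) ^ 2
      = Rsum φ f u * Real.sin (φ u) - deriv (Rsum φ f) u * Real.cos (φ u) / deriv φ u := by
    rw [hR, Rsum]
    field_simp
    linear_combination -(f u * deriv φ u ^ 3) * Real.sin_sq_add_cos_sq (φ u)
  have h1 : lapIII φ (fun s t => f s * Real.cos t) u v
      = (Rsum φ f u * Real.sin (φ u)
          - deriv (Rsum φ f) u * Real.cos (φ u) / deriv φ u) * Real.cos v := by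
    rw [← hcoef, lapIII, deriv_deriv_mul_const, deriv_deriv_const_mul_cos, hf2,
      deriv_mul_const_field, hfu.deriv]
    field_simp
    ring
  have h2 : lapIII φ (fun s t => f s * Real.sin t) u v
      = (Rsum φ f u * Real.sin (φ u)
          - deriv (Rsum φ f) u * Real.cos (φ u) / deriv φ u) * Real.sin v := by
    rw [← hcoef, lapIII, deriv_deriv_mul_const, deriv_deriv_const_mul_sin, hf2,
      deriv_mul_const_field, hfu.deriv]
    field_simp
    ring
  have h3 : lapIII φ (fun s _ => g s) u v
      = -(deriv (Rsum φ f) u * Real.sin (φ u) / deriv φ u) - Rsum φ f u * Real.cos (φ u) := by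
    simp only [lapIII, deriv_const', deriv_const]
    rw [hg2, hgu.deriv, hR, Rsum]
    field_simp
    ring
  refine ⟨⟨h1, h2, h3⟩, ?_⟩
  rw [h1, h2, h3, hx]
  simp only [nMap, Prod.smul_mk, Prod.mk_sub_mk, smul_eq_mul, Prod.mk.injEq]
  refine ⟨?_, ?_, ?_⟩ <;> ring
end

section
/- At every (u,v) ∈ I × ℝ, the support function satisfies Δ^{III} W = 2W − R, i.e. Δ^{III} W(u,v) = 2W(u,v) − R(u). -/
open Real

/-- The support function `W = −⟨x, N⟩ = f sin φ − g cos φ`. -/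
noncomputable def Wsup (φ f g : ℝ → ℝ) (u : ℝ) : ℝ :=
  f u * Real.sin (φ u) - g u * Real.cos (φ u)

/-- The derivative of the support function is `φ' (f cos φ + g sin φ)`. -/
theorem hasDerivAt_Wsup {φ f g : ℝ → ℝ} {u p : ℝ} (hφ : HasDerivAt φ p u)
    (hf : HasDerivAt f (Real.cos (φ u)) u) (hg : HasDerivAt g (Real.sin (φ u)) u) :
    HasDerivAt (Wsup φ f g) (p * (f u * Real.cos (φ u) + g u * Real.sin (φ u))) u := by
  refine ((hf.mul hφ.sin).sub (hg.mul hφ.cos)).congr_deriv ?_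
  ring

/-- The second derivative of the support function, `W'' = φ'' (f cos φ + g sin φ) + φ' - φ'² W`,
computed from the formula for its first derivative. -/
theorem hasDerivAt_mul_tangential {φ f g p : ℝ → ℝ} {u q : ℝ} (hφ : HasDerivAt φ (p u) u)
    (hp : HasDerivAt p q u)
    (hf : HasDerivAt f (Real.cos (φ u)) u) (hg : HasDerivAt g (Real.sin (φ u)) u) :
    HasDerivAt (fun s => p s * (f s * Real.cos (φ s) + g s * Real.sin (φ s)))
      (q * (f u * Real.cos (φ u) + g u * Real.sin (φ u)) + p u - p u ^ 2 * Wsup φ f g u) u := by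
  refine (hp.mul ((hf.mul hφ.cos).add (hg.mul hφ.sin))).congr_deriv ?_
  simp only [Wsup, Pi.add_apply, Pi.mul_apply]
  linear_combination p u * Real.sin_sq_add_cos_sq (φ u)

/-- the support function satisfies Δ^III W = 2W − R. -/
theorem lapIII_support_eq_two_W_sub_R
    (a b : ℝ) (φ f g : ℝ → ℝ)
    (hφ : ContDiff ℝ (⊤ : ℕ∞) φ) (hf : ContDiff ℝ (⊤ : ℕ∞) f) (hg : ContDiff ℝ (⊤ : ℕ∞) g)
    (hfd : ∀ u ∈ Set.Ioo a b, deriv f u = Real.cos (φ u))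
    (hgd : ∀ u ∈ Set.Ioo a b, deriv g u = Real.sin (φ u))
    (hfpos : ∀ u ∈ Set.Ioo a b, 0 < f u)
    (hsin : ∀ u ∈ Set.Ioo a b, Real.sin (φ u) ≠ 0)
    (hφd : ∀ u ∈ Set.Ioo a b, deriv φ u ≠ 0)
    :
    ∀ u ∈ Set.Ioo a b, ∀ v : ℝ,
      lapIII φ (fun s _ => Wsup φ f g s) u v = 2 * Wsup φ f g u - Rsum φ f u := by
  intro u hu v
  have hφ' : ∀ s, HasDerivAt φ (deriv φ s) s := fun s =>
    (hφ.differentiable (by simp) s).hasDerivAt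
  have hφ'' : HasDerivAt (deriv φ) (deriv (deriv φ) u) u :=
    ((contDiff_infty_iff_deriv.1 hφ).2.differentiable (by simp) u).hasDerivAt
  have hf' : ∀ s ∈ Set.Ioo a b, HasDerivAt f (Real.cos (φ s)) s := fun s hs =>
    hfd s hs ▸ (hf.differentiable (by simp) s).hasDerivAt
  have hg' : ∀ s ∈ Set.Ioo a b, HasDerivAt g (Real.sin (φ s)) s := fun s hs =>
    hgd s hs ▸ (hg.differentiable (by simp) s).hasDerivAt
  have hW : ∀ s ∈ Set.Ioo a b, deriv (Wsup φ f g) s =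
      deriv φ s * (f s * Real.cos (φ s) + g s * Real.sin (φ s)) := fun s hs =>
    (hasDerivAt_Wsup (hφ' s) (hf' s hs) (hg' s hs)).deriv
  have hW' := ((hasDerivAt_mul_tangential (hφ' u) hφ'' (hf' u hu) (hg' u hu)).congr_of_eventuallyEq
    (Filter.eventuallyEq_of_mem (isOpen_Ioo.mem_nhds hu) hW)).deriv
  have hs := hsin u hu
  have hp := hφd u hu
  simp only [lapIII, deriv_const', deriv_const, hW', hW u hu]
  simp only [Wsup, Rsum]
  field_simp
  linear_combination (-(f u * Real.sin (φ u) * deriv φ u ^ 2)) * Real.sin_sq_add_cos_sq (φ u)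
end

section
/- Suppose there is k ∈ ℝ such that Δ^{III} x = k x componentwise at every point of I × ℝ (the surface is of finite III-type 1 with eigenvalue k). Then R(u) = k·W(u,v) for all (u,v) ∈ I × ℝ, and both W and R are eigenfunctions of Δ^{III} with eigenvalue 2 − k: Δ^{III} W = (2−k) W and Δ^{III} R = (2−k) R on I × ℝ. -/
open Real

/-- `Δ^III` of a function of `u` alone with prescribed derivatives. -/
lemma lapIII_of_hasDerivAt {φ h h' : ℝ → ℝ} {h'' u : ℝ} (v : ℝ)
    (hh : ∀ᶠ s in nhds u, HasDerivAt h (h' s) s) (hh' : HasDerivAt h' h'' u) :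
    lapIII φ (fun s _ => h s) u v =
      -(1 / (deriv φ u) ^ 2) * h''
        + (deriv (deriv φ) u / (deriv φ u) ^ 3
          - Real.cos (φ u) / (deriv φ u * Real.sin (φ u))) * h' u := by
  have h1 : deriv h =ᶠ[nhds u] h' := hh.mono fun s hs => hs.deriv
  simp [lapIII, h1.deriv_eq, h1.eq_of_nhds, hh'.deriv]

/-- `Δ^III` of `h(u) cos v` on the meridian `v = 0`. -/
lemma lapIII_mul_cos_zero {φ h h' : ℝ → ℝ} {h'' u : ℝ}
    (hh : ∀ᶠ s in nhds u, HasDerivAt h (h' s) s) (hh' : HasDerivAt h' h'' u) :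
    lapIII φ (fun s t => h s * Real.cos t) u 0 =
      -(1 / (deriv φ u) ^ 2) * h''
        + (deriv (deriv φ) u / (deriv φ u) ^ 3
          - Real.cos (φ u) / (deriv φ u * Real.sin (φ u))) * h' u
        + h u / Real.sin (φ u) ^ 2 := by
  have h1 : deriv h =ᶠ[nhds u] h' := hh.mono fun s hs => hs.deriv
  have h2 : deriv (fun s => h u * Real.cos s) = fun s => h u * -Real.sin s :=
    funext fun s => ((Real.hasDerivAt_cos s).const_mul (h u)).deriv
  have h3 : deriv (fun s => h u * -Real.sin s) 0 = h u * -Real.cos 0 :=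
    ((Real.hasDerivAt_sin 0).neg.const_mul (h u)).deriv
  simp only [lapIII, h2, h3, Real.cos_zero, mul_one]
  rw [h1.deriv_eq, h1.eq_of_nhds, hh'.deriv]
  ring

/-- For every surface of revolution, `Δ^III W = 2 W − R`. -/
lemma lapIII_Wsup {φ f g : ℝ → ℝ} {u : ℝ} (v : ℝ)
    (hφ : ∀ᶠ s in nhds u, HasDerivAt φ (deriv φ s) s)
    (hφ' : HasDerivAt (deriv φ) (deriv (deriv φ) u) u)
    (hf : ∀ᶠ s in nhds u, HasDerivAt f (Real.cos (φ s)) s)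
    (hg : ∀ᶠ s in nhds u, HasDerivAt g (Real.sin (φ s)) s)
    (hsin : Real.sin (φ u) ≠ 0) (hφd : deriv φ u ≠ 0) :
    lapIII φ (fun s _ => Wsup φ f g s) u v = 2 * Wsup φ f g u - Rsum φ f u := by
  have hW : ∀ᶠ s in nhds u, HasDerivAt (Wsup φ f g)
      (deriv φ s * (f s * Real.cos (φ s) + g s * Real.sin (φ s))) s := by
    filter_upwards [hφ, hf, hg] with s hφs hfs hgs
    refine ((hfs.mul hφs.sin).sub (hgs.mul hφs.cos)).congr_deriv ?_
    ring
  have hW' := hφ'.mul ((hf.self_of_nhds.mul hφ.self_of_nhds.cos).add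
    (hg.self_of_nhds.mul hφ.self_of_nhds.sin))
  rw [lapIII_of_hasDerivAt v hW hW']
  simp only [Wsup, Rsum, Pi.add_apply, Pi.mul_apply]
  field_simp
  grind [Real.sin_sq_add_cos_sq (φ u)]

/-- If `Δ^III x = k x` along the meridian `v = 0`, then `R = k W`. -/
lemma Rsum_eq_mul_Wsup {φ f g : ℝ → ℝ} {u k : ℝ}
    (hφ : HasDerivAt φ (deriv φ u) u)
    (hf : ∀ᶠ s in nhds u, HasDerivAt f (Real.cos (φ s)) s)
    (hg : ∀ᶠ s in nhds u, HasDerivAt g (Real.sin (φ s)) s)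
    (hsin : Real.sin (φ u) ≠ 0) (hφd : deriv φ u ≠ 0)
    (hx : lapIII φ (fun s t => f s * Real.cos t) u 0 = k * f u)
    (hz : lapIII φ (fun s _ => g s) u 0 = k * g u) :
    Rsum φ f u = k * Wsup φ f g u := by
  rw [lapIII_mul_cos_zero hf hφ.cos] at hx
  rw [lapIII_of_hasDerivAt 0 hg hφ.sin] at hz
  have hW : k * Wsup φ f g u = k * f u * Real.sin (φ u) - k * g u * Real.cos (φ u) := by
    rw [Wsup]
    ring
  rw [hW, ← hx, ← hz, Rsum]
  field_simp
  grind [Real.sin_sq_add_cos_sq (φ u)]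

/-- Theorem 1: if the surface is of finite III-type 1 with eigenvalue k, then
R = kW, and W and R are eigenfunctions of Δ^III with eigenvalue 2 − k. -/
theorem support_and_R_eigenfunctions_of_typeOne
    (a b : ℝ) (φ f g : ℝ → ℝ)
    (hφ : ContDiff ℝ (⊤ : ℕ∞) φ) (hf : ContDiff ℝ (⊤ : ℕ∞) f) (hg : ContDiff ℝ (⊤ : ℕ∞) g)
    (hfd : ∀ u ∈ Set.Ioo a b, deriv f u = Real.cos (φ u))
    (hgd : ∀ u ∈ Set.Ioo a b, deriv g u = Real.sin (φ u))
    (hfpos : ∀ u ∈ Set.Ioo a b, 0 < f u)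
    (hsin : ∀ u ∈ Set.Ioo a b, Real.sin (φ u) ≠ 0)
    (hφd : ∀ u ∈ Set.Ioo a b, deriv φ u ≠ 0)
    (k : ℝ)
    (htype : ∀ u ∈ Set.Ioo a b, ∀ v : ℝ,
      lapIII φ (fun s t => f s * Real.cos t) u v = k * (f u * Real.cos v)
        ∧ lapIII φ (fun s t => f s * Real.sin t) u v = k * (f u * Real.sin v)
        ∧ lapIII φ (fun s _ => g s) u v = k * g u) :
    ∀ u ∈ Set.Ioo a b, ∀ v : ℝ,
      Rsum φ f u = k * Wsup φ f g u
        ∧ lapIII φ (fun s _ => Wsup φ f g s) u v = (2 - k) * Wsup φ f g u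
        ∧ lapIII φ (fun s _ => Rsum φ f s) u v = (2 - k) * Rsum φ f u := by
  have hφ1 : ∀ s, HasDerivAt φ (deriv φ s) s := fun s =>
    (hφ.differentiable (by simp)).differentiableAt.hasDerivAt
  have hφ2 : ∀ s, HasDerivAt (deriv φ) (deriv (deriv φ) s) s := fun s =>
    ((contDiff_infty_iff_deriv.mp hφ).2.differentiable (by simp)).differentiableAt.hasDerivAt
  have hI : ∀ u ∈ Set.Ioo a b, ∀ᶠ s in nhds u, s ∈ Set.Ioo a b := fun u hu =>
    isOpen_Ioo.mem_nhds hu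
  have hf1 : ∀ u ∈ Set.Ioo a b, ∀ᶠ s in nhds u, HasDerivAt f (Real.cos (φ s)) s := fun u hu =>
    (hI u hu).mono fun s hs =>
      hfd s hs ▸ (hf.differentiable (by simp)).differentiableAt.hasDerivAt
  have hg1 : ∀ u ∈ Set.Ioo a b, ∀ᶠ s in nhds u, HasDerivAt g (Real.sin (φ s)) s := fun u hu =>
    (hI u hu).mono fun s hs =>
      hgd s hs ▸ (hg.differentiable (by simp)).differentiableAt.hasDerivAt
  have hR : ∀ u ∈ Set.Ioo a b, Rsum φ f u = k * Wsup φ f g u := fun u hu =>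
    Rsum_eq_mul_Wsup (hφ1 u) (hf1 u hu) (hg1 u hu) (hsin u hu) (hφd u hu)
      (by simpa using (htype u hu 0).1) (htype u hu 0).2.2
  intro u hu v
  have hW : lapIII φ (fun s _ => Wsup φ f g s) u v = (2 - k) * Wsup φ f g u := by
    rw [lapIII_Wsup v (.of_forall hφ1) (hφ2 u) (hf1 u hu) (hg1 u hu) (hsin u hu) (hφd u hu),
      hR u hu]
    ring
  refine ⟨hR u hu, hW, ?_⟩
  have hRW : Rsum φ f =ᶠ[nhds u] fun s => k * Wsup φ f g s := (hI u hu).mono hR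
  have hlap : lapIII φ (fun s _ => Rsum φ f s) u v
      = k * lapIII φ (fun s _ => Wsup φ f g s) u v := by
    have hmul : deriv (fun s => k * Wsup φ f g s) = fun s => k * deriv (Wsup φ f g) s :=
      funext fun s => deriv_const_mul_field k
    have h1 : deriv (Rsum φ f) u = k * deriv (Wsup φ f g) u := by
      rw [hRW.deriv_eq, hmul]
    have h2 : deriv (deriv (Rsum φ f)) u = k * deriv (deriv (Wsup φ f g)) u := by
      rw [hRW.deriv.deriv_eq, hmul, deriv_const_mul_field]
    simp only [lapIII, h1, h2, deriv_const', deriv_const]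
    ring
  rw [hlap, hW, hR u hu]
  ring
end

section
/- If φ'(u) = −sin φ(u)/f(u) for all u ∈ I (the surface is a minimal surface of revolution), then the function u ↦ f(u) sin φ(u) is constant on I, equal to some c ≠ 0, and there exists a ∈ ℝ such that f(u)² = (u − a)² + c² for all u ∈ I; that is, the surface is a catenoid. -/
open Real

/-- a minimal surface of revolution is a catenoid: f sin φ is a nonzero
constant c and f(u)² = (u − u₀)² + c² for some u₀. -/
theorem minimal_surface_of_revolution_is_catenoid
    (a b : ℝ) (φ f g : ℝ → ℝ)
    (hφ : ContDiff ℝ (⊤ : ℕ∞) φ) (hf : ContDiff ℝ (⊤ : ℕ∞) f) (hg : ContDiff ℝ (⊤ : ℕ∞) g)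
    (hfd : ∀ u ∈ Set.Ioo a b, deriv f u = Real.cos (φ u))
    (hgd : ∀ u ∈ Set.Ioo a b, deriv g u = Real.sin (φ u))
    (hfpos : ∀ u ∈ Set.Ioo a b, 0 < f u)
    (hsin : ∀ u ∈ Set.Ioo a b, Real.sin (φ u) ≠ 0)
    (hφd : ∀ u ∈ Set.Ioo a b, deriv φ u ≠ 0)
    (hmin : ∀ u ∈ Set.Ioo a b, deriv φ u = -(Real.sin (φ u)) / f u) :
    ∃ c : ℝ, c ≠ 0 ∧ (∀ u ∈ Set.Ioo a b, f u * Real.sin (φ u) = c) ∧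
      ∃ u₀ : ℝ, ∀ u ∈ Set.Ioo a b, f u ^ 2 = (u - u₀) ^ 2 + c ^ 2 := by
  have hφ' : ∀ u ∈ Set.Ioo a b, HasDerivAt φ (-(sin (φ u)) / f u) u := fun u hu =>
    hmin u hu ▸ (hφ.differentiable (by simp) u).hasDerivAt
  have hf' : ∀ u ∈ Set.Ioo a b, HasDerivAt f (cos (φ u)) u := fun u hu =>
    hfd u hu ▸ (hf.differentiable (by simp) u).hasDerivAt
  have hS : ∀ u ∈ Set.Ioo a b, HasDerivAt (fun u => f u * sin (φ u)) 0 u := fun u hu => by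
    have hne := (hfpos u hu).ne'
    refine ((hf' u hu).mul (hφ' u hu).sin).congr_deriv ?_
    field_simp
    ring
  have hC : ∀ u ∈ Set.Ioo a b, HasDerivAt (fun u => f u * cos (φ u) - u) 0 u := fun u hu => by
    have hne := (hfpos u hu).ne'
    refine (((hf' u hu).mul (hφ' u hu).cos).sub (hasDerivAt_id u)).congr_deriv ?_
    field_simp
    linarith [sin_sq_add_cos_sq (φ u)]
  obtain ⟨c, hc⟩ := isOpen_Ioo.exists_is_const_of_deriv_eq_zero isPreconnected_Ioo
    (fun u hu => (hS u hu).differentiableAt.differentiableWithinAt) fun u hu => (hS u hu).deriv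
  obtain ⟨d, hd⟩ := isOpen_Ioo.exists_is_const_of_deriv_eq_zero isPreconnected_Ioo
    (fun u hu => (hC u hu).differentiableAt.differentiableWithinAt) fun u hu => (hC u hu).deriv
  rcases (Set.Ioo a b).eq_empty_or_nonempty with hempty | ⟨w, hw⟩
  · exact ⟨1, one_ne_zero, by simp [hempty], 0, by simp [hempty]⟩
  · refine ⟨c, hc w hw ▸ mul_ne_zero (hfpos w hw).ne' (hsin w hw), hc, -d, fun u hu => ?_⟩
    have hcos : u - -d = f u * cos (φ u) := by linarith [hd u hu]
    rw [hcos, ← hc u hu]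
    linear_combination -(f u ^ 2) * sin_sq_add_cos_sq (φ u)
end

section
/- If R(u) = c for all u ∈ I (c ∈ ℝ a constant), then for every integer m ≥ 1, the m-fold iterate of the Laplacian satisfies (Δ^{III})^m x = −2^{m−1} c N componentwise at every point of I × ℝ. -/
open Real

/-- `lapIII` of a function that agrees with a product `p s * q t` over an open set of `s`. -/
theorem lapIII_eq_of_eqOn_mul {φ : ℝ → ℝ} {S : Set ℝ} (hS : IsOpen S) {h : ℝ → ℝ → ℝ}
    {p p' p'' q q' q'' : ℝ → ℝ} (hh : ∀ u ∈ S, ∀ v, h u v = p u * q v)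
    (hp : ∀ u ∈ S, HasDerivAt p (p' u) u) (hp' : ∀ u ∈ S, HasDerivAt p' (p'' u) u)
    (hq : ∀ v, HasDerivAt q (q' v) v) (hq' : ∀ v, HasDerivAt q' (q'' v) v)
    {u : ℝ} (hu : u ∈ S) (v : ℝ) :
    lapIII φ h u v = -(1 / (deriv φ u) ^ 2) * (p'' u * q v)
      + (deriv (deriv φ) u / (deriv φ u) ^ 3
          - Real.cos (φ u) / (deriv φ u * Real.sin (φ u))) * (p' u * q v)
      - (1 / Real.sin (φ u) ^ 2) * (p u * q'' v) := by
  have h1 : ∀ x ∈ S, deriv (fun s => h s v) x = p' x * q v := fun x hx => by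
    have : (fun s => h s v) =ᶠ[nhds x] fun s => p s * q v := by
      filter_upwards [hS.mem_nhds hx] with s hs using hh s hs v
    rw [this.deriv_eq, ((hp x hx).mul_const (q v)).deriv]
  have h2 : deriv (deriv (fun s => h s v)) u = p'' u * q v := by
    have : deriv (fun s => h s v) =ᶠ[nhds u] fun s => p' s * q v := by
      filter_upwards [hS.mem_nhds hu] with s hs using h1 s hs
    rw [this.deriv_eq, ((hp' u hu).mul_const (q v)).deriv]
  have h3 : deriv (deriv (fun s => h u s)) v = p u * q'' v := by
    have e : (fun s => h u s) = fun s => p u * q s := funext fun s => hh u hu s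
    have e' : deriv (fun s => p u * q s) = fun s => p u * q' s :=
      funext fun s => ((hq s).const_mul (p u)).deriv
    rw [e, e', ((hq' v).const_mul (p u)).deriv]
  rw [lapIII, h1 u hu, h2, h3]

/-- If, over `S`, `lapIII` maps `h₀` to `-c * k` and `k` is an eigenfunction with eigenvalue `2`,
then the iterates of `h₀` double from the first one on. -/
theorem iterate_lapIII_eq {φ : ℝ → ℝ} {S : Set ℝ} {h₀ k : ℝ → ℝ → ℝ} {c : ℝ}
    (h_seed : ∀ u ∈ S, ∀ v, lapIII φ h₀ u v = -c * k u v)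
    (h_eigen : ∀ (r : ℝ) (h : ℝ → ℝ → ℝ), (∀ u ∈ S, ∀ v, h u v = r * k u v) →
      ∀ u ∈ S, ∀ v, lapIII φ h u v = 2 * r * k u v)
    (m : ℕ) (hm : 1 ≤ m) :
    ∀ u ∈ S, ∀ v, (lapIII φ)^[m] h₀ u v = -(2 ^ (m - 1) : ℝ) * c * k u v := by
  induction m, hm using Nat.le_induction with
  | base => simpa using h_seed
  | succ n hn ih =>
    intro u hu v
    rw [Function.iterate_succ_apply', h_eigen _ _ ih u hu v]
    obtain ⟨j, rfl⟩ := Nat.exists_eq_add_of_le' hn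
    simp only [Nat.add_sub_cancel]
    ring

section Eigenfunctions

variable {φ : ℝ → ℝ} {S : Set ℝ}

/-- `sin φ(u)` times a trigonometric function of frequency one has eigenvalue `2`. -/
theorem lapIII_eq_of_eqOn_sin_mul (hφ : ContDiff ℝ 2 φ) (hS : IsOpen S)
    (hsin : ∀ u ∈ S, Real.sin (φ u) ≠ 0) (hφd : ∀ u ∈ S, deriv φ u ≠ 0)
    {q q' : ℝ → ℝ} (hq : ∀ v, HasDerivAt q (q' v) v) (hq' : ∀ v, HasDerivAt q' (-q v) v)
    (r : ℝ) (h : ℝ → ℝ → ℝ)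
    (hh : ∀ u ∈ S, ∀ v, h u v = r * (-(Real.sin (φ u)) * q v)) :
    ∀ u ∈ S, ∀ v, lapIII φ h u v = 2 * r * (-(Real.sin (φ u)) * q v) := by
  intro u hu v
  have d1 (x : ℝ) : HasDerivAt φ (deriv φ x) x :=
    (hφ.differentiable (by norm_num)).differentiableAt.hasDerivAt
  have d2 (x : ℝ) : HasDerivAt (deriv φ) (deriv (deriv φ) x) x :=
    (hφ.differentiable_deriv_two).differentiableAt.hasDerivAt
  rw [lapIII_eq_of_eqOn_mul hS (h := h) (p := fun s => -r * Real.sin (φ s)) (q := q)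
    (fun u hu v => by rw [hh u hu v]; ring)
    (fun x _ => (d1 x).sin.const_mul (-r))
    (fun x _ => ((d1 x).cos.mul (d2 x)).const_mul (-r)) hq hq' hu v]
  have hs := hsin u hu
  have hd := hφd u hu
  field_simp
  linear_combination (r * q v * deriv φ u ^ 2) * Real.sin_sq_add_cos_sq (φ u)

/-- `cos φ(u)` has eigenvalue `2`. -/
theorem lapIII_eq_of_eqOn_cos (hφ : ContDiff ℝ 2 φ) (hS : IsOpen S)
    (hsin : ∀ u ∈ S, Real.sin (φ u) ≠ 0) (hφd : ∀ u ∈ S, deriv φ u ≠ 0)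
    (r : ℝ) (h : ℝ → ℝ → ℝ) (hh : ∀ u ∈ S, ∀ v : ℝ, h u v = r * Real.cos (φ u)) :
    ∀ u ∈ S, ∀ v : ℝ, lapIII φ h u v = 2 * r * Real.cos (φ u) := by
  intro u hu v
  have d1 (x : ℝ) : HasDerivAt φ (deriv φ x) x :=
    (hφ.differentiable (by norm_num)).differentiableAt.hasDerivAt
  have d2 (x : ℝ) : HasDerivAt (deriv φ) (deriv (deriv φ) x) x :=
    (hφ.differentiable_deriv_two).differentiableAt.hasDerivAt
  rw [lapIII_eq_of_eqOn_mul hS (h := h) (p := fun s => r * Real.cos (φ s)) (q := fun _ => 1)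
    (q' := fun _ => 0) (q'' := fun _ => 0)
    (fun u hu v => by rw [hh u hu v]; ring)
    (fun x _ => (d1 x).cos.const_mul r)
    (fun x _ => ((d1 x).sin.fun_neg.mul (d2 x)).const_mul r)
    (fun v => hasDerivAt_const v _) (fun v => hasDerivAt_const v _) hu v]
  have hs := hsin u hu
  have hd := hφd u hu
  field_simp
  ring

end Eigenfunctions

/-- Where `Rsum φ f` is constant, its vanishing derivative determines `φ''`. -/
theorem deriv_deriv_div_of_Rsum_const {φ f : ℝ → ℝ} {S : Set ℝ} {c : ℝ} (hS : IsOpen S)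
    (hφ : ContDiff ℝ 2 φ) (hf : ∀ u ∈ S, HasDerivAt f (Real.cos (φ u)) u)
    (hsin : ∀ u ∈ S, Real.sin (φ u) ≠ 0) (hφd : ∀ u ∈ S, deriv φ u ≠ 0)
    (hR : ∀ u ∈ S, Rsum φ f u = c) {u : ℝ} (hu : u ∈ S) :
    deriv (deriv φ) u / (deriv φ u) ^ 3
        - Real.cos (φ u) / (deriv φ u * Real.sin (φ u))
      = -(f u * Real.cos (φ u) / Real.sin (φ u) ^ 2) := by
  have d1 : HasDerivAt φ (deriv φ u) u :=
    (hφ.differentiable (by norm_num)).differentiableAt.hasDerivAt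
  have d2 : HasDerivAt (deriv φ) (deriv (deriv φ) u) u :=
    (hφ.differentiable_deriv_two).differentiableAt.hasDerivAt
  have hs := hsin u hu
  have hd := hφd u hu
  have hc : HasDerivAt (fun s => f s / Real.sin (φ s) + 1 / deriv φ s) 0 u :=
    (hasDerivAt_const u c).congr_of_eventuallyEq <| by
      filter_upwards [hS.mem_nhds hu] with s h_mem using hR s h_mem
  have key := (((hf u hu).fun_div d1.sin hs).fun_add
    ((hasDerivAt_const u (1 : ℝ)).fun_div d2 hd)).unique hc
  field_simp at key ⊢
  linear_combination -key

/-- if R ≡ c then (Δ^III)^m x = −2^(m−1) c N componentwise for all m ≥ 1. -/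
theorem iterate_lapIII_x_of_R_const
    (a b : ℝ) (φ f g : ℝ → ℝ)
    (hφ : ContDiff ℝ (⊤ : ℕ∞) φ) (hf : ContDiff ℝ (⊤ : ℕ∞) f) (hg : ContDiff ℝ (⊤ : ℕ∞) g)
    (hfd : ∀ u ∈ Set.Ioo a b, deriv f u = Real.cos (φ u))
    (hgd : ∀ u ∈ Set.Ioo a b, deriv g u = Real.sin (φ u))
    (hfpos : ∀ u ∈ Set.Ioo a b, 0 < f u)
    (hsin : ∀ u ∈ Set.Ioo a b, Real.sin (φ u) ≠ 0)
    (hφd : ∀ u ∈ Set.Ioo a b, deriv φ u ≠ 0)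
    (c : ℝ) (hR : ∀ u ∈ Set.Ioo a b, Rsum φ f u = c) :
    ∀ m : ℕ, 1 ≤ m → ∀ u ∈ Set.Ioo a b, ∀ v : ℝ,
      (lapIII φ)^[m] (fun s t => f s * Real.cos t) u v
          = -(2 ^ (m - 1) : ℝ) * c * (-(Real.sin (φ u)) * Real.cos v)
        ∧ (lapIII φ)^[m] (fun s t => f s * Real.sin t) u v
          = -(2 ^ (m - 1) : ℝ) * c * (-(Real.sin (φ u)) * Real.sin v)
        ∧ (lapIII φ)^[m] (fun s _ => g s) u v
          = -(2 ^ (m - 1) : ℝ) * c * Real.cos (φ u) := by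
  have hφ2 : ContDiff ℝ 2 φ := hφ.of_le (by exact WithTop.coe_le_coe.2 le_top)
  have d1 (x : ℝ) : HasDerivAt φ (deriv φ x) x :=
    (hφ2.differentiable (by norm_num)).differentiableAt.hasDerivAt
  have hf' : ∀ u ∈ Set.Ioo a b, HasDerivAt f (Real.cos (φ u)) u := fun u hu =>
    hfd u hu ▸ (hf.differentiable (by simp)).differentiableAt.hasDerivAt
  have hg' : ∀ u ∈ Set.Ioo a b, HasDerivAt g (Real.sin (φ u)) u := fun u hu =>
    hgd u hu ▸ (hg.differentiable (by simp)).differentiableAt.hasDerivAt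
  have hcoef {u : ℝ} (hu : u ∈ Set.Ioo a b) :=
    deriv_deriv_div_of_Rsum_const isOpen_Ioo hφ2 hf' hsin hφd hR hu
  have seed {q q' : ℝ → ℝ} (hq : ∀ v, HasDerivAt q (q' v) v)
      (hq' : ∀ v, HasDerivAt q' (-q v) v) : ∀ u ∈ Set.Ioo a b, ∀ v,
      lapIII φ (fun s t => f s * q t) u v = -c * (-(Real.sin (φ u)) * q v) := by
    intro u hu v
    rw [lapIII_eq_of_eqOn_mul isOpen_Ioo (fun _ _ _ => rfl) hf' (fun x _ => (d1 x).cos) hq hq' hu v,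
      hcoef hu, ← hR u hu, Rsum]
    have hs := hsin u hu
    have hd := hφd u hu
    field_simp
    linear_combination (-f u * q v * deriv φ u) * Real.sin_sq_add_cos_sq (φ u)
  have seed_g : ∀ u ∈ Set.Ioo a b, ∀ v : ℝ,
      lapIII φ (fun s _ => g s) u v = -c * Real.cos (φ u) := by
    intro u hu v
    rw [lapIII_eq_of_eqOn_mul isOpen_Ioo (h := fun s _ => g s) (p := g)
      (q := fun _ => 1) (q' := fun _ => 0) (q'' := fun _ => 0)
      (fun x _ _ => (mul_one (g x)).symm) hg' (fun x _ => (d1 x).sin)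
      (fun v => hasDerivAt_const v _) (fun v => hasDerivAt_const v _) hu v,
      hcoef hu, ← hR u hu, Rsum]
    have hs := hsin u hu
    have hd := hφd u hu
    field_simp
    ring
  have hsin' (v : ℝ) : HasDerivAt (fun t => -Real.sin t) (-Real.cos v) v :=
    (Real.hasDerivAt_sin v).fun_neg
  intro m hm u hu v
  exact ⟨iterate_lapIII_eq (k := fun u v => -(Real.sin (φ u)) * Real.cos v)
      (seed Real.hasDerivAt_cos hsin')
      (lapIII_eq_of_eqOn_sin_mul hφ2 isOpen_Ioo hsin hφd Real.hasDerivAt_cos hsin') m hm u hu v,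
    iterate_lapIII_eq (k := fun u v => -(Real.sin (φ u)) * Real.sin v)
      (seed Real.hasDerivAt_sin Real.hasDerivAt_cos)
      (lapIII_eq_of_eqOn_sin_mul hφ2 isOpen_Ioo hsin hφd Real.hasDerivAt_sin
        Real.hasDerivAt_cos) m hm u hu v,
    iterate_lapIII_eq (k := fun u _ => Real.cos (φ u)) seed_g
      (lapIII_eq_of_eqOn_cos hφ2 isOpen_Ioo hsin hφd) m hm u hu v⟩
end

section
/- If R(u) = c for all u ∈ I (c ∈ ℝ a constant), then Δ^{III}(Δ^{III} x) = 2 Δ^{III} x componentwise at every point of I × ℝ; that is, x is annihilated by the monic polynomial P(Δ^{III}) with P(t) = t² − 2t, so a surface of revolution with constant sum of principal radii of curvature is of finite (null) III-type at most 2. -/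
open Real

open Topology in
/-- The operator `lapIII` on a function that agrees with `F(s) w(t)` for `s` near `u`, where
`w'' = k w` at `v`. -/
theorem lapIII_eq_of_eventually_eq_mul {φ F F' w : ℝ → ℝ} {h : ℝ → ℝ → ℝ} {u v F'' k : ℝ}
    (hh : ∀ᶠ s in 𝓝 u, ∀ t, h s t = F s * w t)
    (hF : ∀ᶠ s in 𝓝 u, HasDerivAt F (F' s) s) (hF' : HasDerivAt F' F'' u)
    (hw : deriv (deriv w) v = k * w v) :
    lapIII φ h u v = (-(1 / deriv φ u ^ 2) * F''
      + (deriv (deriv φ) u / deriv φ u ^ 3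
        - Real.cos (φ u) / (deriv φ u * Real.sin (φ u))) * F' u
      - 1 / Real.sin (φ u) ^ 2 * (k * F u)) * w v := by
  have hd : deriv (fun s => h s v) =ᶠ[𝓝 u] fun s => F' s * w v := by
    filter_upwards [hh.eventually_nhds, hF] with s hs hFs
    have : (fun s => h s v) =ᶠ[𝓝 s] fun s => F s * w v := hs.mono fun r hr => hr v
    rw [this.deriv_eq, (hFs.mul_const _).deriv]
  have hv : (fun t => h u t) = fun t => F u * w t := funext hh.self_of_nhds
  have hvv : deriv (deriv fun t => h u t) v = F u * (k * w v) := by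
    rw [hv, ← hw, show (deriv fun t => F u * w t) = fun t => F u * deriv w t from
      deriv_const_mul_field' (F u), deriv_const_mul_field]
  rw [lapIII, hvv, hd.deriv_eq, (hF'.mul_const _).deriv, hd.self_of_nhds]
  ring

theorem hasDerivAt_deriv_of_contDiff {φ : ℝ → ℝ} (hφ : ContDiff ℝ (⊤ : ℕ∞) φ) (u : ℝ) :
    HasDerivAt (deriv φ) (deriv (deriv φ) u) u :=
  ((contDiff_infty_iff_deriv.1 hφ).2.differentiable (by simp)).differentiableAt.hasDerivAt

theorem deriv_deriv_cos (v : ℝ) : deriv (deriv Real.cos) v = -1 * Real.cos v := by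
  simp [Real.deriv_cos']

theorem deriv_deriv_sin (v : ℝ) : deriv (deriv Real.sin) v = -1 * Real.sin v := by
  simp [Real.deriv_sin]

open Topology in
/-- The horizontal components of the Gauss map are eigenfunctions of `lapIII` with eigenvalue
`2`. -/
theorem lapIII_const_mul_sin_mul {φ w : ℝ → ℝ} {h : ℝ → ℝ → ℝ} {u v : ℝ} (c : ℝ)
    (hφ : ContDiff ℝ (⊤ : ℕ∞) φ) (hs : Real.sin (φ u) ≠ 0) (hp : deriv φ u ≠ 0)
    (hh : ∀ᶠ s in 𝓝 u, ∀ t, h s t = c * Real.sin (φ s) * w t)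
    (hw : deriv (deriv w) v = -1 * w v) :
    lapIII φ h u v = 2 * h u v := by
  have hφ1 (s : ℝ) : HasDerivAt φ (deriv φ s) s :=
    (hφ.differentiable (by simp)).differentiableAt.hasDerivAt
  have hφ2 : HasDerivAt (deriv φ) (deriv (deriv φ) u) u :=
    hasDerivAt_deriv_of_contDiff hφ u
  rw [lapIII_eq_of_eventually_eq_mul hh
    (.of_forall fun s => ((hφ1 s).sin.const_mul c)) (((hφ1 u).cos.mul hφ2).const_mul c) hw,
    hh.self_of_nhds]
  field_simp
  linear_combination (-w v * c * deriv φ u ^ 2) * Real.sin_sq_add_cos_sq (φ u)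

open Topology in
/-- The vertical component of the Gauss map is an eigenfunction of `lapIII` with eigenvalue
`2`. -/
theorem lapIII_const_mul_cos {φ : ℝ → ℝ} {h : ℝ → ℝ → ℝ} {u v : ℝ} (c : ℝ)
    (hφ : ContDiff ℝ (⊤ : ℕ∞) φ) (hs : Real.sin (φ u) ≠ 0) (hp : deriv φ u ≠ 0)
    (hh : ∀ᶠ s in 𝓝 u, ∀ t, h s t = c * Real.cos (φ s)) :
    lapIII φ h u v = 2 * h u v := by
  have hφ1 (s : ℝ) : HasDerivAt φ (deriv φ s) s :=
    (hφ.differentiable (by simp)).differentiableAt.hasDerivAt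
  have hφ2 : HasDerivAt (deriv φ) (deriv (deriv φ) u) u :=
    hasDerivAt_deriv_of_contDiff hφ u
  rw [lapIII_eq_of_eventually_eq_mul (w := fun _ => 1) (k := 0)
    (hh.mono fun s hs t => by rw [hs t, mul_one])
    (.of_forall fun s => ((hφ1 s).cos.const_mul c)) (((hφ1 u).sin.neg.mul hφ2).const_mul c)
    (by simp), hh.self_of_nhds]
  simp only [Pi.neg_apply]
  field_simp
  ring

open Topology in
/-- Differentiating `R = c` expresses `φ''` through `φ` and `φ'`. -/
theorem deriv_deriv_mul_sin_of_Rsum_eq {φ f : ℝ → ℝ} {u c : ℝ}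
    (hφ : ContDiff ℝ (⊤ : ℕ∞) φ) (hf : HasDerivAt f (Real.cos (φ u)) u)
    (hs : Real.sin (φ u) ≠ 0) (hp : deriv φ u ≠ 0) (hR : ∀ᶠ s in 𝓝 u, Rsum φ f s = c) :
    deriv (deriv φ) u * Real.sin (φ u)
      = deriv φ u ^ 2 * Real.cos (φ u) * (2 - c * deriv φ u) := by
  have hφ1 : HasDerivAt φ (deriv φ u) u :=
    (hφ.differentiable (by simp)).differentiableAt.hasDerivAt
  have hφ2 : HasDerivAt (deriv φ) (deriv (deriv φ) u) u :=
    hasDerivAt_deriv_of_contDiff hφ u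
  have hd := ((hf.div hφ1.sin hs).add ((hasDerivAt_const u (1 : ℝ)).div hφ2 hp)).unique
    ((hasDerivAt_const u c).congr_of_eventuallyEq hR)
  have hRu : f u / Real.sin (φ u) + 1 / deriv φ u = c := hR.self_of_nhds
  rw [← hRu]
  field_simp at hd ⊢
  linear_combination -hd

open Topology in
theorem lapIII_mul_of_Rsum_eq {φ f w : ℝ → ℝ} {u v c : ℝ}
    (hφ : ContDiff ℝ (⊤ : ℕ∞) φ) (hf : ∀ᶠ s in 𝓝 u, HasDerivAt f (Real.cos (φ s)) s)
    (hs : Real.sin (φ u) ≠ 0) (hp : deriv φ u ≠ 0) (hR : ∀ᶠ s in 𝓝 u, Rsum φ f s = c)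
    (hw : deriv (deriv w) v = -1 * w v) :
    lapIII φ (fun s t => f s * w t) u v = c * Real.sin (φ u) * w v := by
  have hφ1 : HasDerivAt φ (deriv φ u) u :=
    (hφ.differentiable (by simp)).differentiableAt.hasDerivAt
  have hode := deriv_deriv_mul_sin_of_Rsum_eq hφ hf.self_of_nhds hs hp hR
  have hfu : f u = Real.sin (φ u) * (c - 1 / deriv φ u) := by
    have hRu : f u / Real.sin (φ u) + 1 / deriv φ u = c := hR.self_of_nhds
    rw [← hRu]
    field_simp
    ring
  rw [lapIII_eq_of_eventually_eq_mul (.of_forall fun s t => rfl) hf hφ1.cos hw, hfu,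
    eq_div_of_mul_eq hs hode]
  congr 1
  field_simp
  linear_combination (1 - c * deriv φ u) * Real.sin_sq_add_cos_sq (φ u)

open Topology in
theorem lapIII_height_of_Rsum_eq {φ f g : ℝ → ℝ} {u v c : ℝ}
    (hφ : ContDiff ℝ (⊤ : ℕ∞) φ) (hf : HasDerivAt f (Real.cos (φ u)) u)
    (hg : ∀ᶠ s in 𝓝 u, HasDerivAt g (Real.sin (φ s)) s)
    (hs : Real.sin (φ u) ≠ 0) (hp : deriv φ u ≠ 0) (hR : ∀ᶠ s in 𝓝 u, Rsum φ f s = c) :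
    lapIII φ (fun s _ => g s) u v = -c * Real.cos (φ u) := by
  have hφ1 : HasDerivAt φ (deriv φ u) u :=
    (hφ.differentiable (by simp)).differentiableAt.hasDerivAt
  have hode := deriv_deriv_mul_sin_of_Rsum_eq hφ hf hs hp hR
  rw [lapIII_eq_of_eventually_eq_mul (w := fun _ => 1) (k := 0)
    (.of_forall fun s t => (mul_one (g s)).symm) hg hφ1.sin (by simp), eq_div_of_mul_eq hs hode]
  field_simp
  ring

/-- if R ≡ c then Δ^III(Δ^III x) = 2 Δ^III x componentwise, i.e. x is
annihilated by P(Δ^III) with P(t) = t² − 2t, so the surface is of finite (null) III-type ≤ 2. -/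
theorem lapIII_sq_x_eq_two_lapIII_x_of_R_const
    (a b : ℝ) (φ f g : ℝ → ℝ)
    (hφ : ContDiff ℝ (⊤ : ℕ∞) φ) (hf : ContDiff ℝ (⊤ : ℕ∞) f) (hg : ContDiff ℝ (⊤ : ℕ∞) g)
    (hfd : ∀ u ∈ Set.Ioo a b, deriv f u = Real.cos (φ u))
    (hgd : ∀ u ∈ Set.Ioo a b, deriv g u = Real.sin (φ u))
    (hfpos : ∀ u ∈ Set.Ioo a b, 0 < f u)
    (hsin : ∀ u ∈ Set.Ioo a b, Real.sin (φ u) ≠ 0)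
    (hφd : ∀ u ∈ Set.Ioo a b, deriv φ u ≠ 0)
    (c : ℝ) (hR : ∀ u ∈ Set.Ioo a b, Rsum φ f u = c) :
    ∀ u ∈ Set.Ioo a b, ∀ v : ℝ,
      lapIII φ (lapIII φ (fun s t => f s * Real.cos t)) u v
          = 2 * lapIII φ (fun s t => f s * Real.cos t) u v
        ∧ lapIII φ (lapIII φ (fun s t => f s * Real.sin t)) u v
          = 2 * lapIII φ (fun s t => f s * Real.sin t) u v
        ∧ lapIII φ (lapIII φ (fun s _ => g s)) u v
          = 2 * lapIII φ (fun s _ => g s) u v := by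
  have hnhds {u : ℝ} (hu : u ∈ Set.Ioo a b) := isOpen_Ioo.mem_nhds hu
  have hfd' (u) (hu : u ∈ Set.Ioo a b) : HasDerivAt f (Real.cos (φ u)) u :=
    hfd u hu ▸ (hf.differentiable (by simp)).differentiableAt.hasDerivAt
  have hgd' (u) (hu : u ∈ Set.Ioo a b) : HasDerivAt g (Real.sin (φ u)) u :=
    hgd u hu ▸ (hg.differentiable (by simp)).differentiableAt.hasDerivAt
  have key (u) (hu : u ∈ Set.Ioo a b) {w : ℝ → ℝ} (v : ℝ)
      (hw : ∀ v, deriv (deriv w) v = -1 * w v) :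
      lapIII φ (lapIII φ (fun s t => f s * w t)) u v
        = 2 * lapIII φ (fun s t => f s * w t) u v := by
    refine lapIII_const_mul_sin_mul c hφ (hsin u hu) (hφd u hu) ?_ (hw v)
    filter_upwards [hnhds hu] with s hs t
    exact lapIII_mul_of_Rsum_eq hφ (Filter.mem_of_superset (hnhds hs) hfd') (hsin s hs)
      (hφd s hs) (Filter.mem_of_superset (hnhds hs) hR) (hw t)
  intro u hu v
  refine ⟨key u hu v deriv_deriv_cos, key u hu v deriv_deriv_sin, ?_⟩
  refine lapIII_const_mul_cos (-c) hφ (hsin u hu) (hφd u hu) ?_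
  filter_upwards [hnhds hu] with s hs t
  exact lapIII_height_of_Rsum_eq hφ (hfd' s hs) (Filter.mem_of_superset (hnhds hs) hgd')
    (hsin s hs) (hφd s hs) (Filter.mem_of_superset (hnhds hs) hR)
end

section
/- Suppose R(u) = c for all u ∈ I with c ≠ 0, and suppose there exist an integer k ≥ 1 and real numbers c₁, …, c_k with c_k ≠ 0 such that (Δ^{III})^k x + c₁ (Δ^{III})^{k−1} x + ⋯ + c_{k−1} Δ^{III} x + c_k x = 0 componentwise at every point of I × ℝ. Then there exists λ ∈ ℝ such that x(u,v) = λ N(u,v) for all (u,v) ∈ I × ℝ; in particular ‖x(u,v)‖ = |λ| is constant, i.e. the surface is part of a sphere centered at the origin. -/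
open Real

/-- The Euclidean inner product on `ℝ³`. -/
def dot3 (p q : ℝ × ℝ × ℝ) : ℝ := p.1 * q.1 + p.2.1 * q.2.1 + p.2.2 * q.2.2

theorem lapIII_of_eq_fst {φ : ℝ → ℝ} {H : ℝ → ℝ → ℝ} {s : Set ℝ} (hs : IsOpen s)
    {p p' : ℝ → ℝ} (hH : ∀ u ∈ s, ∀ v, H u v = p u) (hp : ∀ u ∈ s, HasDerivAt p (p' u) u)
    {u p'' : ℝ} (hu : u ∈ s) (hp' : HasDerivAt p' p'' u) (v : ℝ) :
    lapIII φ H u v = -(1 / (deriv φ u) ^ 2) * p''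
      + (deriv (deriv φ) u / (deriv φ u) ^ 3
        - Real.cos (φ u) / (deriv φ u * Real.sin (φ u))) * p' u := by
  have first : ∀ w ∈ s, deriv (fun t => H t v) w = p' w := fun w hw =>
    ((hp w hw).congr_of_eventuallyEq
      (Filter.eventually_of_mem (hs.mem_nhds hw) fun t ht => hH t ht v)).deriv
  have second : deriv (deriv (fun t => H t v)) u = p'' :=
    (hp'.congr_of_eventuallyEq
      (Filter.eventually_of_mem (hs.mem_nhds hu) fun t ht => first t ht)).deriv
  have hv : (fun t => H u t) = fun _ => p u := funext fun t => hH u hu t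
  simp [lapIII, second, first u hu, hv]

theorem lapIII_const_mul_cos_s16 {φ : ℝ → ℝ} {H : ℝ → ℝ → ℝ} {s : Set ℝ} (hs : IsOpen s)
    (hφ : ∀ u ∈ s, HasDerivAt φ (deriv φ u) u)
    (hφ' : ∀ u ∈ s, HasDerivAt (deriv φ) (deriv (deriv φ) u) u)
    (hsin : ∀ u ∈ s, Real.sin (φ u) ≠ 0) (hφd : ∀ u ∈ s, deriv φ u ≠ 0) {A : ℝ}
    (hH : ∀ u ∈ s, ∀ v, H u v = A * Real.cos (φ u)) {u : ℝ} (hu : u ∈ s) (v : ℝ) :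
    lapIII φ H u v = (2 * A) * Real.cos (φ u) := by
  rw [lapIII_of_eq_fst hs hH (fun w hw => ((hφ w hw).cos).const_mul A) hu
    ((((hφ u hu).sin.neg).mul (hφ' u hu)).const_mul A)]
  have h1 := hsin u hu
  have h2 := hφd u hu
  simp only [Pi.neg_apply]
  field_simp
  ring

theorem HasDerivAt.eq_of_eqOn_open {p q : ℝ → ℝ} {s : Set ℝ} (hs : IsOpen s)
    (h : ∀ u ∈ s, p u = q u) {u p' q' : ℝ} (hu : u ∈ s) (hp : HasDerivAt p p' u)
    (hq : HasDerivAt q q' u) : p' = q' :=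
  hp.unique (hq.congr_of_eventuallyEq (Filter.eventually_of_mem (hs.mem_nhds hu) h))

/-- if R ≡ c ≠ 0 and x satisfies a monic polynomial equation in Δ^III with
nonzero constant term c_k, then x = λN for some λ, so the surface is part of a sphere
centered at the origin. -/
theorem sphere_of_finite_type_and_R_const
    (a b : ℝ) (φ f g : ℝ → ℝ)
    (hφ : ContDiff ℝ (⊤ : ℕ∞) φ) (hf : ContDiff ℝ (⊤ : ℕ∞) f) (hg : ContDiff ℝ (⊤ : ℕ∞) g)
    (hfd : ∀ u ∈ Set.Ioo a b, deriv f u = Real.cos (φ u))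
    (hgd : ∀ u ∈ Set.Ioo a b, deriv g u = Real.sin (φ u))
    (hfpos : ∀ u ∈ Set.Ioo a b, 0 < f u)
    (hsin : ∀ u ∈ Set.Ioo a b, Real.sin (φ u) ≠ 0)
    (hφd : ∀ u ∈ Set.Ioo a b, deriv φ u ≠ 0)
    (c : ℝ) (hc : c ≠ 0) (hR : ∀ u ∈ Set.Ioo a b, Rsum φ f u = c)
    (k : ℕ) (hk : 1 ≤ k) (cs : ℕ → ℝ) (hck : cs k ≠ 0)
    (heq : ∀ u ∈ Set.Ioo a b, ∀ v : ℝ,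
      (lapIII φ)^[k] (fun s t => f s * Real.cos t) u v
          + ∑ i ∈ Finset.range k,
              cs (i + 1) * (lapIII φ)^[k - (i + 1)] (fun s t => f s * Real.cos t) u v = 0
        ∧ (lapIII φ)^[k] (fun s t => f s * Real.sin t) u v
            + ∑ i ∈ Finset.range k,
                cs (i + 1) * (lapIII φ)^[k - (i + 1)] (fun s t => f s * Real.sin t) u v = 0
        ∧ (lapIII φ)^[k] (fun s _ => g s) u v
            + ∑ i ∈ Finset.range k,
                cs (i + 1) * (lapIII φ)^[k - (i + 1)] (fun s _ => g s) u v = 0) :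
    ∃ lam : ℝ,
      (∀ u ∈ Set.Ioo a b, ∀ v : ℝ, xMap f g u v = lam • nMap φ u v)
        ∧ ∀ u ∈ Set.Ioo a b, ∀ v : ℝ,
            dot3 (xMap f g u v) (xMap f g u v) = lam ^ 2 := by
  set I := Set.Ioo a b
  have ho : IsOpen I := isOpen_Ioo
  have dφ : ∀ u ∈ I, HasDerivAt φ (deriv φ u) u := fun u _ =>
    (hφ.differentiable (by simp) u).hasDerivAt
  have dφ' : ∀ u ∈ I, HasDerivAt (deriv φ) (deriv (deriv φ) u) u := fun u _ =>
    (((contDiff_infty_iff_deriv.1 hφ).2).differentiable (by simp) u).hasDerivAt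
  have df : ∀ u ∈ I, HasDerivAt f (Real.cos (φ u)) u := fun u hu =>
    hfd u hu ▸ (hf.differentiable (by simp) u).hasDerivAt
  have dg : ∀ u ∈ I, HasDerivAt g (Real.sin (φ u)) u := fun u hu =>
    hgd u hu ▸ (hg.differentiable (by simp) u).hasDerivAt
  have radii : ∀ u ∈ I, f u * deriv φ u + Real.sin (φ u)
      = c * (Real.sin (φ u) * deriv φ u) := by
    intro u hu
    have h1 := hsin u hu
    have h2 := hφd u hu
    have h := hR u hu
    simp only [Rsum] at h
    field_simp at h
    linarith
  have radii' : ∀ u ∈ I, Real.cos (φ u) * deriv φ u + f u * deriv (deriv φ) u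
      + Real.cos (φ u) * deriv φ u = c * (Real.cos (φ u) * deriv φ u * deriv φ u
      + Real.sin (φ u) * deriv (deriv φ) u) := fun u hu =>
    HasDerivAt.eq_of_eqOn_open ho radii hu (((df u hu).mul (dφ' u hu)).add (dφ u hu).sin)
      (((dφ u hu).sin.mul (dφ' u hu)).const_mul c)
  have lap_g : ∀ u ∈ I, ∀ v, lapIII φ (fun s _ => g s) u v = -c * Real.cos (φ u) := by
    intro u hu v
    rw [lapIII_of_eq_fst (H := fun s _ => g s) ho (fun _ _ _ => rfl) dg hu (dφ u hu).sin]
    have h1 := hsin u hu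
    have h2 := hφd u hu
    have h3 := radii u hu
    have h4 := radii' u hu
    field_simp
    have h5 : Real.sin (φ u) * deriv (deriv φ) u = deriv φ u *
        (2 * Real.cos (φ u) * deriv φ u - c * Real.cos (φ u) * deriv φ u ^ 2) := by
      linear_combination deriv (deriv φ) u * h3 - deriv φ u * h4
    linear_combination h5
  have iter : ∀ j : ℕ, ∀ u ∈ I, ∀ v, (lapIII φ)^[j + 1] (fun s _ => g s) u v
      = (-c * 2 ^ j) * Real.cos (φ u) := by
    intro j
    induction j with
    | zero => simpa using lap_g
    | succ j ih =>
      intro u hu v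
      rw [Function.iterate_succ_apply', lapIII_const_mul_cos_s16 ho dφ dφ' hsin hφd ih hu v]
      ring
  obtain ⟨n, rfl⟩ : ∃ n, k = n + 1 := ⟨k - 1, by omega⟩
  obtain ⟨μ, hμ⟩ : ∃ μ : ℝ, ∀ u ∈ I, g u = μ * Real.cos (φ u) := by
    refine ⟨-(-c * 2 ^ n + ∑ i ∈ Finset.range n, cs (i + 1) * (-c * 2 ^ (n - i - 1)))
      / cs (n + 1), fun u hu => ?_⟩
    have h := (heq u hu 0).2.2
    rw [Finset.sum_range_succ, iter n u hu] at h
    have hsum : ∑ i ∈ Finset.range n,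
        cs (i + 1) * (lapIII φ)^[n + 1 - (i + 1)] (fun s _ => g s) u 0
        = (∑ i ∈ Finset.range n, cs (i + 1) * (-c * 2 ^ (n - i - 1))) * Real.cos (φ u) := by
      rw [Finset.sum_mul]
      refine Finset.sum_congr rfl fun i hi => ?_
      have hi' := Finset.mem_range.1 hi
      rw [show n + 1 - (i + 1) = (n - i - 1) + 1 by omega, iter _ u hu]
      ring
    rw [hsum] at h
    simp only [Nat.sub_self, Function.iterate_zero, id_eq] at h
    rw [div_mul_eq_mul_div, eq_div_iff hck]
    linear_combination h
  have hμ' : ∀ u ∈ I, 1 = -μ * deriv φ u := by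
    intro u hu
    have h := HasDerivAt.eq_of_eqOn_open ho hμ hu (dg u hu) ((dφ u hu).cos.const_mul μ)
    exact mul_left_cancel₀ (hsin u hu) (by linarith)
  have f_eq : ∀ u ∈ I, f u = (c + μ) * Real.sin (φ u) := fun u hu => by
    linear_combination (-μ) * radii u hu + (f u - c * Real.sin (φ u)) * hμ' u hu
  have cos_eq : ∀ u ∈ I, (c + 2 * μ) * Real.cos (φ u) = 0 := fun u hu => by
    have h := HasDerivAt.eq_of_eqOn_open ho f_eq hu (df u hu) ((dφ u hu).sin.const_mul (c + μ))
    linear_combination μ * h + (c + μ) * Real.cos (φ u) * hμ' u hu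
  have c_eq : ∀ u ∈ I, c + 2 * μ = 0 := fun u hu => by
    have h := HasDerivAt.eq_of_eqOn_open ho cos_eq hu ((dφ u hu).cos.const_mul (c + 2 * μ))
      (hasDerivAt_const u 0)
    simpa [hsin u hu, hφd u hu] using h
  have f_eq' : ∀ u ∈ I, f u = -(μ * Real.sin (φ u)) := fun u hu => by
    linear_combination f_eq u hu + Real.sin (φ u) * c_eq u hu
  refine ⟨μ, fun u hu v => ?_, fun u hu v => ?_⟩
  · simp [xMap, nMap, f_eq' u hu, hμ u hu, mul_assoc]
  · simp only [xMap, dot3, f_eq' u hu, hμ u hu]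
    linear_combination μ ^ 2 * Real.sin (φ u) ^ 2 * Real.sin_sq_add_cos_sq v
      + μ ^ 2 * Real.sin_sq_add_cos_sq (φ u)
end
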